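/- arXiv:2303.03262 — 3 statements merged into one kernel-verified Lean document; each statement's English description precedes it below -/
import Mathlib

section
/- (Seidel–Stern type criterion, Theorem IV.2, unit-numerator form) Let $(p_n)_{n \ge 0}$ be a sequence of positive real numbers and let $B_n$ be the denominator sequence of the continued fraction $K_{n=0}^{\infty}(1/p_n)$, i.e. $B_n = p_n B_{n-1} + B_{n-2}$ with $B_{-2}=0$, $B_{-1}=1$. Then the sequence of approximants $C_n = A_n/B_n$ (equivalently, the partial sums $C_n = \sum_{k=0}^{n}(-1)^k/(B_k B_{k-1})$) converges in $\mathbb{R}$ if and only if the series $\sum_{n=0}^{\infty} p_n$ diverges. -/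
open Filter

section ThreeTermRecurrence

variable {q a b : ℕ → ℝ}

/-- The solutions of a three-term recurrence with nonnegative coefficients and positive initial
values are bounded below by the smaller initial value. -/
theorem min_le_of_recurrence (hq : ∀ n, 0 ≤ q n) (h0 : 0 < b 0) (h1 : 0 < b 1)
    (hb : ∀ n, b (n + 2) = q n * b (n + 1) + b n) (n : ℕ) : min (b 0) (b 1) ≤ b n := by
  have hc : 0 < min (b 0) (b 1) := lt_min h0 h1
  suffices h : min (b 0) (b 1) ≤ b n ∧ min (b 0) (b 1) ≤ b (n + 1) from h.1
  induction n with
  | zero => exact ⟨min_le_left _ _, min_le_right _ _⟩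
  | succ k ih =>
    refine ⟨ih.2, ?_⟩
    rw [hb k]
    have := mul_nonneg (hq k) (hc.le.trans ih.2)
    linarith [ih.1]

/-- The determinant formula for two solutions of the same three-term recurrence. -/
theorem recurrence_determinant (ha : ∀ n, a (n + 2) = q n * a (n + 1) + a n)
    (hb : ∀ n, b (n + 2) = q n * b (n + 1) + b n) (n : ℕ) :
    a (n + 1) * b n - a n * b (n + 1) = (-1) ^ n * (a 1 * b 0 - a 0 * b 1) := by
  induction n with
  | zero => simp
  | succ k ih =>
    rw [ha k, hb k, pow_succ]
    linear_combination -ih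

theorem recurrence_mul_succ (hb : ∀ n, b (n + 2) = q n * b (n + 1) + b n) (n : ℕ) :
    b (n + 1) * b (n + 2) = b n * b (n + 1) + q n * b (n + 1) ^ 2 := by
  rw [hb n]
  ring

/-- If the coefficients are not summable, the products of consecutive terms tend to infinity. -/
theorem tendsto_recurrence_mul_atTop (hq : ∀ n, 0 ≤ q n) (h0 : 0 < b 0) (h1 : 0 < b 1)
    (hb : ∀ n, b (n + 2) = q n * b (n + 1) + b n) (hs : ¬ Summable q) :
    Tendsto (fun n => b n * b (n + 1)) atTop atTop := by
  have hc : 0 < min (b 0) (b 1) := lt_min h0 h1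
  have key (n : ℕ) :
      min (b 0) (b 1) ^ 2 * ∑ i ∈ Finset.range n, q i ≤ b n * b (n + 1) := by
    induction n with
    | zero => simpa using (mul_pos h0 h1).le
    | succ k ih =>
      rw [Finset.sum_range_succ, recurrence_mul_succ hb k]
      have h := mul_le_mul_of_nonneg_left
        (pow_le_pow_left₀ hc.le (min_le_of_recurrence hq h0 h1 hb (k + 1)) 2) (hq k)
      linarith
  exact tendsto_atTop_mono key
    (((not_summable_iff_tendsto_nat_atTop_of_nonneg hq).1 hs).const_mul_atTop (by positivity))

/-- If the coefficients are summable, the sums of consecutive terms are bounded. -/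
theorem recurrence_add_le (hq : ∀ n, 0 ≤ q n) (h0 : 0 < b 0) (h1 : 0 < b 1)
    (hb : ∀ n, b (n + 2) = q n * b (n + 1) + b n) (hs : Summable q) (n : ℕ) :
    b n + b (n + 1) ≤ (b 0 + b 1) * Real.exp (∑' i, q i) := by
  have hpos (n : ℕ) : 0 < b n := (lt_min h0 h1).trans_le (min_le_of_recurrence hq h0 h1 hb n)
  have key : b n + b (n + 1) ≤ (b 0 + b 1) * Real.exp (∑ i ∈ Finset.range n, q i) := by
    induction n with
    | zero => simp
    | succ k ih =>
      rw [Finset.sum_range_succ, Real.exp_add, ← mul_assoc]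
      calc b (k + 1) + b (k + 2) ≤ (b k + b (k + 1)) * (q k + 1) := by
            rw [hb k]
            nlinarith [mul_nonneg (hq k) (hpos k).le]
        _ ≤ _ := mul_le_mul ih (Real.add_one_le_exp _) (by linarith [hq k]) (by positivity)
  refine key.trans ?_
  gcongr
  exact hs.sum_le_tsum _ fun i _ => hq i

/-- Seidel–Stern criterion for quotients of two solutions of a three-term recurrence. -/
theorem exists_tendsto_recurrence_div_iff (hq : ∀ n, 0 ≤ q n) (h0 : 0 < b 0) (h1 : 0 < b 1)
    (hb : ∀ n, b (n + 2) = q n * b (n + 1) + b n) (ha : ∀ n, a (n + 2) = q n * a (n + 1) + a n)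
    (ha0 : a 0 = 0) (hab : a 1 * b 0 = 1) :
    (∃ L : ℝ, Tendsto (fun n => a n / b n) atTop (nhds L)) ↔ ¬ Summable q := by
  have hpos (n : ℕ) : 0 < b n := (lt_min h0 h1).trans_le (min_le_of_recurrence hq h0 h1 hb n)
  have hdiff (n : ℕ) :
      a (n + 1) / b (n + 1) - a n / b n = (-1) ^ n * (b n * b (n + 1))⁻¹ := by
    have hd := recurrence_determinant ha hb n
    rw [ha0, hab, zero_mul, sub_zero, mul_one] at hd
    rw [← hd]
    have := (hpos n).ne'
    have := (hpos (n + 1)).ne'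
    field_simp
  constructor
  · rintro ⟨L, hL⟩ hs
    have hzero : Tendsto (fun n => (b n * b (n + 1))⁻¹) atTop (nhds 0) := by
      have h := (((tendsto_add_atTop_iff_nat 1).2 hL).sub hL).abs
      simp only [hdiff, sub_self, abs_zero, abs_mul, abs_pow, abs_neg, abs_one, one_pow,
        one_mul] at h
      refine h.congr fun n => abs_of_pos ?_
      have := hpos n
      have := hpos (n + 1)
      positivity
    set M := (b 0 + b 1) * Real.exp (∑' i, q i)
    have hM : 0 < M := by positivity
    have hle (n : ℕ) : (M ^ 2)⁻¹ ≤ (b n * b (n + 1))⁻¹ := by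
      have := hpos n
      have := hpos (n + 1)
      have hn : b n + b (n + 1) ≤ M := recurrence_add_le hq h0 h1 hb hs n
      apply inv_anti₀ (by positivity)
      rw [sq]
      exact mul_le_mul (by linarith) (by linarith) (by positivity) hM.le
    exact (ge_of_tendsto' hzero hle).not_gt (by positivity)
  · intro hs
    have hanti : Antitone fun n => (b n * b (n + 1))⁻¹ := by
      refine antitone_nat_of_succ_le fun n => ?_
      apply inv_anti₀ (mul_pos (hpos n) (hpos (n + 1)))
      rw [recurrence_mul_succ hb n]
      exact le_add_of_nonneg_right (mul_nonneg (hq n) (sq_nonneg _))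
    obtain ⟨L, hL⟩ := hanti.tendsto_alternating_series_of_tendsto_zero
      (tendsto_recurrence_mul_atTop hq h0 h1 hb hs).inv_tendsto_atTop
    refine ⟨L, hL.congr fun n => ?_⟩
    rw [← Finset.sum_congr rfl fun i _ => hdiff i, Finset.sum_range_sub (fun n => a n / b n)]
    simp [ha0]

end ThreeTermRecurrence

/-- Seidel–Stern type criterion, unit-numerator form: For a sequence of
positive reals `p n`, the approximants `C n = A n / B n` of the continued fraction
`K (1 / p n)` converge in `ℝ` if and only if the series `∑ p n` diverges. -/
theorem seidel_stern_criterion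
    (p : ℕ → ℝ) (hp : ∀ n, 0 < p n) (A B : ℤ → ℝ)
    (hA2 : A (-2) = 1) (hA1 : A (-1) = 0)
    (hB2 : B (-2) = 0) (hB1 : B (-1) = 1)
    (hA : ∀ n : ℕ, A n = p n * A ((n : ℤ) - 1) + A ((n : ℤ) - 2))
    (hB : ∀ n : ℕ, B n = p n * B ((n : ℤ) - 1) + B ((n : ℤ) - 2)) :
    (∃ L : ℝ, Tendsto (fun n : ℕ => A n / B n) atTop (nhds L)) ↔ ¬ Summable p := by
  have hA0 : A 0 = 1 := by simpa [hA1, hA2] using hA 0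
  have hB0 : B 0 = p 0 := by simpa [hB1, hB2] using hB 0
  have shift {X : ℤ → ℝ}
      (hX : ∀ n : ℕ, X n = p n * X ((n : ℤ) - 1) + X ((n : ℤ) - 2)) (n : ℕ) :
      X (((n + 2 : ℕ) : ℤ) - 1) =
        p (n + 1) * X (((n + 1 : ℕ) : ℤ) - 1) + X ((n : ℤ) - 1) := by
    have h := hX (n + 1)
    rw [show ((n + 1 : ℕ) : ℤ) - 2 = (n : ℤ) - 1 by push_cast; ring] at h
    rw [← h]
    congr 1
    push_cast
    ring
  have key := exists_tendsto_recurrence_div_iff (q := fun n => p (n + 1))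
    (a := fun n => A ((n : ℤ) - 1)) (b := fun n => B ((n : ℤ) - 1))
    (fun n => (hp (n + 1)).le) (by simp [hB1]) (by simp [hB0, hp 0])
    (shift hB) (shift hA) (by simp [hA1]) (by simp [hA0, hB1])
  rw [summable_nat_add_iff 1] at key
  rw [← key]
  refine exists_congr fun L => ?_
  rw [← tendsto_add_atTop_iff_nat (f := fun n : ℕ => A ((n : ℤ) - 1) / B ((n : ℤ) - 1)) 1]
  simp
end

section
/- Let $(p_n)_{n \ge 0}$ be a sequence of positive real numbers, let $B_n$ be the denominator sequence of the continued fraction $K_{n=0}^{\infty}(1/p_n)$, and set $\mu = \min(1, p_0)$. Then $B_n \ge \mu$ for all $n \ge -1$, and $B_{n-1} B_n \ge \mu^2 \sum_{k=0}^{n} p_k$ for every $n \ge 0$. In particular, if $\sum_{n=0}^{\infty} p_n$ diverges then $B_{n-1}B_n \to \infty$ as $n \to \infty$. -/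
open Filter

/-- For a sequence of positive reals `p n`, the denominators `B n` of the
continued fraction `K (1 / p n)` satisfy, with `μ = min 1 (p 0)`:
`B n ≥ μ` for all `n ≥ -1` and `B (n-1) * B n ≥ μ² * ∑_{k=0}^{n} p k` for all `n ≥ 0`.
In particular, if `∑ p n` diverges then `B (n-1) * B n → ∞`. -/
theorem denominator_product_lower_bound
    (p : ℕ → ℝ) (hp : ∀ n, 0 < p n) (B : ℤ → ℝ)
    (hB2 : B (-2) = 0) (hB1 : B (-1) = 1)
    (hB : ∀ n : ℕ, B n = p n * B ((n : ℤ) - 1) + B ((n : ℤ) - 2)) :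
    (∀ n : ℤ, -1 ≤ n → min 1 (p 0) ≤ B n) ∧
    (∀ n : ℕ, (min 1 (p 0)) ^ 2 * ∑ k ∈ Finset.range (n + 1), p k
        ≤ B ((n : ℤ) - 1) * B n) ∧
    (¬ Summable p → Tendsto (fun n : ℕ => B ((n : ℤ) - 1) * B n) atTop atTop) := by
  have hμ : 0 < min 1 (p 0) := lt_min one_pos (hp 0)
  have hsucc (n : ℕ) : B ((n + 1 : ℕ) : ℤ) = p (n + 1) * B n + B ((n : ℤ) - 1) := by
    rw [hB (n + 1), show ((n + 1 : ℕ) : ℤ) - 1 = n by lia,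
      show ((n + 1 : ℕ) : ℤ) - 2 = n - 1 by lia]
  have hB0 : B 0 = p 0 := by simpa [hB1, hB2] using hB 0
  have hpair (n : ℕ) : min 1 (p 0) ≤ B ((n : ℤ) - 1) ∧ min 1 (p 0) ≤ B n := by
    induction n with
    | zero => simp [hB0, hB1]
    | succ n ih =>
      rw [hsucc, show ((n + 1 : ℕ) : ℤ) - 1 = n by lia]
      have := mul_pos (hp (n + 1)) (hμ.trans_le ih.2)
      exact ⟨ih.2, by linarith [ih.1]⟩
  have hbound (n : ℕ) : (min 1 (p 0)) ^ 2 * ∑ k ∈ Finset.range (n + 1), p k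
      ≤ B ((n : ℤ) - 1) * B n := by
    induction n with
    | zero =>
      have hsq : (min 1 (p 0)) ^ 2 ≤ 1 := pow_le_one₀ hμ.le (min_le_left _ _)
      simpa [hB0, hB1] using mul_le_mul_of_nonneg_right hsq (hp 0).le
    | succ n ih =>
      rw [Finset.sum_range_succ, hsucc, show ((n + 1 : ℕ) : ℤ) - 1 = n by lia]
      have hsq : (min 1 (p 0)) ^ 2 ≤ B n ^ 2 := pow_le_pow_left₀ hμ.le (hpair n).2 2
      linarith [mul_le_mul_of_nonneg_right hsq (hp (n + 1)).le]
  refine ⟨fun n hn => ?_, hbound, fun hdiv => ?_⟩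
  · obtain ⟨m, hm⟩ := Int.eq_ofNat_of_zero_le (by lia : 0 ≤ n + 1)
    obtain rfl : n = (m : ℤ) - 1 := by lia
    exact (hpair m).1
  · have hsum := (not_summable_iff_tendsto_nat_atTop_of_nonneg fun n => (hp n).le).1 hdiv
    exact tendsto_atTop_mono hbound
      ((hsum.comp (tendsto_add_atTop_nat 1)).const_mul_atTop (pow_pos hμ 2))
end

section
/- (Theorem IV.4) Let $(p_n)_{n \ge 0}$ be a real sequence with $p_n \ge 1$ for all $n \ge 0$, and let $C_n$ be the approximants of the continued fraction $K_{n=0}^{\infty}(1/p_n)$. Then with $\mu = \min(1, p_0)$ one has $|C_n - C_{n-1}| \le \dfrac{1}{(n+1)\mu^2}$ for every $n \ge 0$; in particular $\lim_{n\to\infty}\,(C_n - C_{n-1}) = 0$. -/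
open Filter

/-- The denominators of a continued fraction with unit numerators and partial denominators at
least `1` are at least `1`, and the product of consecutive ones grows at least linearly. -/
lemma denominators_growth (p : ℕ → ℝ) (hp : ∀ n, 1 ≤ p n) (B : ℤ → ℝ)
    (hB2 : B (-2) = 0) (hB1 : B (-1) = 1)
    (hB : ∀ n : ℕ, B n = p n * B ((n : ℤ) - 1) + B ((n : ℤ) - 2)) (n : ℕ) :
    1 ≤ B ((n : ℤ) - 1) ∧ 1 ≤ B n ∧ (n : ℝ) + 1 ≤ B n * B ((n : ℤ) - 1) := by
  induction n with
  | zero =>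
    have h := hB 0
    norm_num [hB1, hB2] at h ⊢
    rw [h]
    exact hp 0
  | succ k ih =>
    obtain ⟨h1, h2, h3⟩ := ih
    have h := hB (k + 1)
    have e1 : ((k + 1 : ℕ) : ℤ) - 1 = k := by omega
    have e2 : ((k + 1 : ℕ) : ℤ) - 2 = k - 1 := by omega
    rw [e1, e2] at h
    rw [e1, h]
    have hpB : 1 ≤ p (k + 1) * B k := one_le_mul_of_one_le_of_one_le (hp _) h2
    refine ⟨h2, by linarith, ?_⟩
    push_cast
    nlinarith [one_le_mul_of_one_le_of_one_le hpB h2]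

/-- The determinant formula for a continued fraction with unit numerators. -/
lemma numerators_denominators_determinant (p : ℕ → ℝ) (A B : ℤ → ℝ)
    (hA2 : A (-2) = 1) (hA1 : A (-1) = 0) (hB1 : B (-1) = 1)
    (hA : ∀ n : ℕ, A n = p n * A ((n : ℤ) - 1) + A ((n : ℤ) - 2))
    (hB : ∀ n : ℕ, B n = p n * B ((n : ℤ) - 1) + B ((n : ℤ) - 2)) (n : ℕ) :
    A n * B ((n : ℤ) - 1) - B n * A ((n : ℤ) - 1) = (-1) ^ n := by
  induction n with
  | zero =>
    have h := hA 0
    norm_num [hA1, hA2] at h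
    norm_num [hA1, hB1, h]
  | succ k ih =>
    have h := hA (k + 1)
    have h' := hB (k + 1)
    have e1 : ((k + 1 : ℕ) : ℤ) - 1 = k := by omega
    have e2 : ((k + 1 : ℕ) : ℤ) - 2 = k - 1 := by omega
    rw [e1, e2] at h h'
    rw [e1, h, h', pow_succ]
    linear_combination -ih

/-- Theorem IV.4: If `p n ≥ 1` for all `n`, then the approximants
`C n = A n / B n` of the continued fraction `K (1 / p n)` satisfy, with
`μ = min 1 (p 0)`, the bound `|C n - C (n-1)| ≤ 1 / ((n+1) * μ²)` for every `n ≥ 0`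
(where `C (-1) = A (-1) / B (-1) = 0`); in particular `C n - C (n-1) → 0`. -/
theorem aim_condition_for_unit_numerators
    (p : ℕ → ℝ) (hp : ∀ n, 1 ≤ p n) (A B : ℤ → ℝ)
    (hA2 : A (-2) = 1) (hA1 : A (-1) = 0)
    (hB2 : B (-2) = 0) (hB1 : B (-1) = 1)
    (hA : ∀ n : ℕ, A n = p n * A ((n : ℤ) - 1) + A ((n : ℤ) - 2))
    (hB : ∀ n : ℕ, B n = p n * B ((n : ℤ) - 1) + B ((n : ℤ) - 2)) :
    (∀ n : ℕ, |A n / B n - A ((n : ℤ) - 1) / B ((n : ℤ) - 1)|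
        ≤ 1 / ((n + 1) * (min 1 (p 0)) ^ 2)) ∧
    Tendsto (fun n : ℕ => A n / B n - A ((n : ℤ) - 1) / B ((n : ℤ) - 1))
      atTop (nhds 0) := by
  have bound : ∀ n : ℕ, |A n / B n - A ((n : ℤ) - 1) / B ((n : ℤ) - 1)|
      ≤ 1 / ((n + 1) * (min 1 (p 0)) ^ 2) := by
    intro n
    obtain ⟨h1, h2, h3⟩ := denominators_growth p hp B hB2 hB1 hB n
    rw [min_eq_left (hp 0), one_pow, mul_one,
      div_sub_div _ _ (by linarith) (by linarith),
      numerators_denominators_determinant p A B hA2 hA1 hB1 hA hB n, abs_div, abs_neg_one_pow,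
      abs_of_pos (by positivity)]
    gcongr
  refine ⟨bound, squeeze_zero_norm (fun n => ?_) tendsto_one_div_add_atTop_nhds_zero_nat⟩
  simpa [min_eq_left (hp 0)] using bound n
end
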